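/- For every real h and all T, T' ≥ 0, one has F_{T+T'}(h) ≥ F_T(h) · F_{T'}(h); that is, the function T ↦ log F_T(h) is superadditive. (Consequence of Slepian's inequality for the stationary Gaussian process S with nonnegative correlation function.) -/

import Mathlib

open MeasureTheory ProbabilityTheory Real Set Filter

/-- The standard normal density `φ(x) = (2π)^{-1/2} exp(-x²/2)`. -/
noncomputable def stdPhi (x : ℝ) : ℝ := (Real.sqrt (2 * Real.pi))⁻¹ * Real.exp (-x ^ 2 / 2)

/-- The standard normal distribution function `Φ(x) = ∫_{-∞}^x φ(t) dt`. -/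
noncomputable def stdCdf (x : ℝ) : ℝ := ∫ t in Set.Iic x, stdPhi t

/-- `S` is a Slepian process on the probability space `(Ω, μ)`: a stationary Gaussian
process with continuous sample paths, mean zero and covariance
`E[S(t)S(t')] = max 0 (1 - |t - t'|)` (e.g. `S(t) = W(t+1) - W(t)` for a standard
Brownian motion `W`). -/
def IsSlepian {Ω : Type*} [MeasurableSpace Ω] (μ : Measure Ω) (S : ℝ → Ω → ℝ) : Prop :=
  IsProbabilityMeasure μ ∧
  (∀ t, Measurable (S t)) ∧
  (∀ ω, Continuous fun t => S t ω) ∧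
  (∀ (n : ℕ) (t c : Fin n → ℝ), ∃ v : NNReal,
      Measure.map (fun ω => ∑ i, c i * S (t i) ω) μ = gaussianReal 0 v) ∧
  (∀ t, ∫ ω, S t ω ∂μ = 0) ∧
  (∀ t t', ∫ ω, S t ω * S t' ω ∂μ = max 0 (1 - |t - t'|))

/-- `F_T(h)`: the probability that the process `S` stays below `h` on `[0, T]`. -/
noncomputable def slepF {Ω : Type*} [MeasurableSpace Ω] (μ : Measure Ω)
    (S : ℝ → Ω → ℝ) (T h : ℝ) : ℝ :=
  (μ {ω | ∀ t ∈ Set.Icc (0 : ℝ) T, S t ω < h}).toReal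

/-- A measure on a preorder is positively associated if bounded antitone functions are
nonnegatively correlated. -/
def PosAssoc {α : Type*} [MeasurableSpace α] [Preorder α] (μ : Measure α) : Prop :=
  ∀ f g : α → ℝ, Measurable f → Measurable g → Antitone f → Antitone g →
    (∀ x, |f x| ≤ 1) → (∀ x, |g x| ≤ 1) →
    (∫ x, f x ∂μ) * (∫ x, g x ∂μ) ≤ ∫ x, f x * g x ∂μ

lemma integrable_of_abs_le_one {α : Type*} [MeasurableSpace α] {μ : Measure α}
    [IsFiniteMeasure μ] {f : α → ℝ} (hf : Measurable f) (h : ∀ x, |f x| ≤ 1) :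
    Integrable f μ :=
  Integrable.of_bound hf.aestronglyMeasurable 1 (ae_of_all _ h)

lemma abs_mul_le_one_of_abs_le_one {a b : ℝ} (ha : |a| ≤ 1) (hb : |b| ≤ 1) : |a * b| ≤ 1 := by
  rw [abs_mul]
  exact mul_le_one₀ ha (abs_nonneg _) hb

lemma abs_integral_le_one {α : Type*} [MeasurableSpace α] {μ : Measure α}
    [IsProbabilityMeasure μ] {f : α → ℝ} (h : ∀ x, |f x| ≤ 1) : |∫ x, f x ∂μ| ≤ 1 := by
  simpa using norm_integral_le_of_norm_le_const (μ := μ) (f := f) (ae_of_all _ h)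

/-- Chebyshev's association inequality. -/
lemma PosAssoc.of_total {α : Type*} [MeasurableSpace α] [Preorder α] (μ : Measure α)
    [IsProbabilityMeasure μ] (htot : ∀ x y : α, x ≤ y ∨ y ≤ x) : PosAssoc μ := by
  intro f g hf hg hfa hga hf1 hg1
  have hfi := integrable_of_abs_le_one (μ := μ) hf hf1
  have hgi := integrable_of_abs_le_one (μ := μ) hg hg1
  have hfgi : Integrable (fun x => f x * g x) μ :=
    integrable_of_abs_le_one (hf.mul hg) fun x => abs_mul_le_one_of_abs_le_one (hf1 x) (hg1 x)
  have hnonneg : 0 ≤ ∫ x, ∫ y, (f x - f y) * (g x - g y) ∂μ ∂μ := by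
    refine integral_nonneg fun x => integral_nonneg fun y => ?_
    rcases htot x y with h | h
    · exact mul_nonneg (sub_nonneg.2 (hfa h)) (sub_nonneg.2 (hga h))
    · exact mul_nonneg_of_nonpos_of_nonpos (sub_nonpos.2 (hfa h)) (sub_nonpos.2 (hga h))
  have hinner : ∀ x, ∫ y, (f x - f y) * (g x - g y) ∂μ =
      f x * g x - f x * (∫ y, g y ∂μ) - ((∫ y, f y ∂μ) * g x - ∫ y, f y * g y ∂μ) := by
    intro x
    have : ∀ y, (f x - f y) * (g x - g y) =
        (f x * g x - f x * g y) - (f y * g x - f y * g y) := fun y => by ring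
    simp_rw [this]
    have h₁ : Integrable (fun y => f x * g x - f x * g y) μ :=
      (integrable_const _).sub (hgi.const_mul _)
    have h₂ : Integrable (fun y => f y * g x - f y * g y) μ := (hfi.mul_const _).sub hfgi
    rw [integral_sub h₁ h₂,
      integral_sub (integrable_const _) (hgi.const_mul _), integral_sub (hfi.mul_const _) hfgi]
    simp [integral_const_mul, integral_mul_const]
  simp_rw [hinner] at hnonneg
  have h₁ : Integrable (fun x => f x * g x - f x * (∫ y, g y ∂μ)) μ :=
    hfgi.sub (hfi.mul_const _)
  have h₂ : Integrable (fun x => (∫ y, f y ∂μ) * g x - ∫ y, f y * g y ∂μ) μ :=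
    (hgi.const_mul _).sub (integrable_const _)
  rw [integral_sub h₁ h₂,
    integral_sub hfgi (hfi.mul_const _), integral_sub (hgi.const_mul _) (integrable_const _),
    integral_const_mul, integral_mul_const] at hnonneg
  simp only [integral_const, probReal_univ, one_smul] at hnonneg
  linarith

lemma PosAssoc.map {α β : Type*} [MeasurableSpace α] [Preorder α] [MeasurableSpace β]
    [Preorder β] {μ : Measure α} (hμ : PosAssoc μ) {φ : α → β} (hφ : Measurable φ)
    (hmono : Monotone φ) : PosAssoc (μ.map φ) := by
  intro f g hf hg hfa hga hf1 hg1
  have hfg : Measurable fun x => f x * g x := hf.mul hg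
  rw [integral_map hφ.aemeasurable hf.aestronglyMeasurable,
    integral_map hφ.aemeasurable hg.aestronglyMeasurable,
    integral_map hφ.aemeasurable hfg.aestronglyMeasurable]
  exact hμ _ _ (hf.comp hφ) (hg.comp hφ) (hfa.comp_monotone hmono) (hga.comp_monotone hmono)
    (fun _ => hf1 _) (fun _ => hg1 _)

lemma PosAssoc.prod {α β : Type*} [MeasurableSpace α] [Preorder α] [MeasurableSpace β]
    [Preorder β] {μ : Measure α} {ν : Measure β} [IsProbabilityMeasure μ]
    [IsProbabilityMeasure ν] (hμ : PosAssoc μ) (hν : PosAssoc ν) : PosAssoc (μ.prod ν) := by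
  intro f g hf hg hfa hga hf1 hg1
  have hfgm : Measurable fun z => f z * g z := hf.mul hg
  have hfg1 : ∀ z, |f z * g z| ≤ 1 := fun z => abs_mul_le_one_of_abs_le_one (hf1 z) (hg1 z)
  have hmeas : ∀ {k : α × β → ℝ}, Measurable k → Measurable fun x => ∫ y, k (x, y) ∂ν :=
    fun hk => hk.stronglyMeasurable.integral_prod_right'.measurable
  have hanti : ∀ {k : α × β → ℝ}, Measurable k → (∀ z, |k z| ≤ 1) → Antitone k →
      Antitone fun x => ∫ y, k (x, y) ∂ν := fun hk hk1 hka x x' hx =>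
    integral_mono (integrable_of_abs_le_one (hk.comp measurable_prodMk_left) fun _ => hk1 _)
      (integrable_of_abs_le_one (hk.comp measurable_prodMk_left) fun _ => hk1 _)
      fun y => hka (Prod.mk_le_mk.2 ⟨hx, le_rfl⟩)
  rw [integral_prod _ (integrable_of_abs_le_one hf hf1),
    integral_prod _ (integrable_of_abs_le_one hg hg1),
    integral_prod _ (integrable_of_abs_le_one hfgm hfg1)]
  refine (hμ _ _ (hmeas hf) (hmeas hg) (hanti hf hf1 hfa) (hanti hg hg1 hga)
    (fun _ => abs_integral_le_one fun _ => hf1 _)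
    (fun _ => abs_integral_le_one fun _ => hg1 _)).trans ?_
  refine integral_mono
    (integrable_of_abs_le_one ((hmeas hf).mul (hmeas hg)) fun _ => abs_mul_le_one_of_abs_le_one
      (abs_integral_le_one fun _ => hf1 _) (abs_integral_le_one fun _ => hg1 _))
    (integrable_of_abs_le_one (hmeas hfgm) fun _ => abs_integral_le_one fun _ => hfg1 _)
    fun x => ?_
  exact hν _ _ (hf.comp measurable_prodMk_left) (hg.comp measurable_prodMk_left)
    (fun y y' hy => hfa (Prod.mk_le_mk.2 ⟨le_rfl, hy⟩))
    (fun y y' hy => hga (Prod.mk_le_mk.2 ⟨le_rfl, hy⟩)) (fun _ => hf1 _) (fun _ => hg1 _)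

/-- Harris inequality for product measures on `Fin n → ℝ`. -/
lemma PosAssoc.pi {n : ℕ} (μ : Fin n → Measure ℝ) [∀ i, IsProbabilityMeasure (μ i)] :
    PosAssoc (Measure.pi μ) := by
  induction n with
  | zero => exact .of_total _ fun x y => Or.inl (Subsingleton.elim x y).le
  | succ n ih =>
    rw [← (measurePreserving_piFinSuccAbove μ 0).symm.map_eq]
    refine ((PosAssoc.of_total (μ 0) le_total).prod (ih _)).map
      (MeasurableEquiv.measurable _) ?_
    rintro ⟨x, y⟩ ⟨x', y'⟩ ⟨hx, hy⟩ i
    refine Fin.cases ?_ (fun i => ?_) i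
    · simpa using hx
    · simpa using hy i

lemma PosAssoc.real_mul_le_real_inter {α : Type*} [MeasurableSpace α] [Preorder α]
    {μ : Measure α} (hμ : PosAssoc μ) {s t : Set α} (hs : MeasurableSet s) (ht : MeasurableSet t)
    (hsl : IsLowerSet s) (htl : IsLowerSet t) : μ.real s * μ.real t ≤ μ.real (s ∩ t) := by
  have hanti : ∀ {u : Set α}, IsLowerSet u → Antitone (u.indicator (1 : α → ℝ)) := by
    intro u hu x y hxy
    by_cases hy : y ∈ u
    · simp [hy, hu hxy hy]
    · rw [Set.indicator_of_notMem hy]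
      exact Set.indicator_nonneg (fun _ _ => zero_le_one) x
  have habs : ∀ (u : Set α) x, |u.indicator (1 : α → ℝ) x| ≤ 1 := by
    intro u x
    by_cases hx : x ∈ u <;> simp [hx]
  have := hμ _ _ (measurable_one.indicator hs) (measurable_one.indicator ht) (hanti hsl)
    (hanti htl) (habs s) (habs t)
  simp_rw [← Set.inter_indicator_mul, Pi.one_apply, mul_one] at this
  rw [integral_indicator_one hs, integral_indicator_one ht] at this
  exact this.trans_eq (integral_indicator_one (hs.inter ht))

lemma StrongDual.exists_pi_apply_eq_sum {ι : Type*} [Fintype ι] (L : StrongDual ℝ (ι → ℝ)) :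
    ∃ c : ι → ℝ, ∀ x, L x = ∑ i, c i * x i := by
  classical
  refine ⟨fun i => L (Pi.single i 1), fun x => ?_⟩
  conv_lhs => rw [pi_eq_sum_univ' x, map_sum]
  refine Finset.sum_congr rfl fun i _ => ?_
  rw [map_smul, smul_eq_mul, mul_comm]

/-- The law of a Gaussian vector is determined by its mean and covariance. -/
lemma HasGaussianLaw.map_eq_of_covariance_eq {ι Ω Ω' : Type*} [Fintype ι] [MeasurableSpace Ω]
    [MeasurableSpace Ω'] {P : Measure Ω} {Q : Measure Ω'} {X : Ω → ι → ℝ} {Y : Ω' → ι → ℝ}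
    (hX : HasGaussianLaw X P) (hY : HasGaussianLaw Y Q)
    (hmean : ∀ i, ∫ ω, X ω i ∂P = ∫ ω, Y ω i ∂Q)
    (hcov : ∀ i j, cov[fun ω => X ω i, fun ω => X ω j; P] =
      cov[fun ω => Y ω i, fun ω => Y ω j; Q]) :
    P.map X = Q.map Y := by
  have := hX.isProbabilityMeasure
  have := hY.isProbabilityMeasure
  have := hX.isGaussian_map
  have := hY.isGaussian_map
  have hX2 : ∀ i, MemLp (fun ω => X ω i) 2 P := fun i => (hX.eval i).memLp_two
  have hY2 : ∀ i, MemLp (fun ω => Y ω i) 2 Q := fun i => (hY.eval i).memLp_two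
  refine Measure.ext_of_charFunDual ?_
  ext L
  rw [hX.charFunDual_map_eq_fun, hY.charFunDual_map_eq_fun]
  obtain ⟨c, hc⟩ := StrongDual.exists_pi_apply_eq_sum L
  simp_rw [hc]
  have hm : ∫ ω, ∑ i, c i * X ω i ∂P = ∫ ω, ∑ i, c i * Y ω i ∂Q := by
    rw [integral_finsetSum _ fun i _ => ((hX.eval i).integrable).const_mul _,
      integral_finsetSum _ fun i _ => ((hY.eval i).integrable).const_mul _]
    simp_rw [integral_const_mul, hmean]
  have hv : Var[fun ω => ∑ i, c i * X ω i; P] =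
      Var[fun ω => ∑ i, c i * Y ω i; Q] := by
    rw [variance_fun_sum fun i => (hX2 i).const_mul _,
      variance_fun_sum fun i => (hY2 i).const_mul _]
    simp_rw [covariance_const_mul_left, covariance_const_mul_right, hcov]
  rw [hm, hv]

/-- A Gaussian vector with the covariance of a nonnegative linear image of independent standard
Gaussian variables has a positively associated law. -/
lemma HasGaussianLaw.posAssoc_map {ι Ω : Type*} [Fintype ι] [MeasurableSpace Ω]
    {P : Measure Ω} {X : Ω → ι → ℝ} (hX : HasGaussianLaw X P) (hmean : ∀ i, ∫ ω, X ω i ∂P = 0)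
    {M : ℕ} (A : ι → Fin M → ℝ) (hA : ∀ i m, 0 ≤ A i m)
    (hcov : ∀ i j, cov[fun ω => X ω i, fun ω => X ω j; P] = ∑ m, A i m * A j m) :
    PosAssoc (P.map X) := by
  set ν : Measure (Fin M → ℝ) := Measure.pi fun _ => gaussianReal 0 1
  have heval : ∀ m, HasLaw (fun z : Fin M → ℝ => z m) (gaussianReal 0 1) ν := fun m =>
    (measurePreserving_eval (fun _ : Fin M => gaussianReal 0 1) m).hasLaw
  have hind : iIndepFun (fun m (z : Fin M → ℝ) => z m) ν :=
    iIndepFun_pi (X := fun _ x => x) fun _ => aemeasurable_id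
  have hG : HasGaussianLaw (fun z : Fin M → ℝ => z) ν :=
    iIndepFun.hasGaussianLaw (fun m => (heval m).hasGaussianLaw) hind
  have hmem : ∀ m, MemLp (fun z : Fin M → ℝ => z m) 2 ν := fun m => (hG.eval m).memLp_two
  set Y : (Fin M → ℝ) → ι → ℝ := fun z i => ∑ m, A i m * z m
  have hY : HasGaussianLaw Y ν :=
    hG.map_fun (LinearMap.toContinuousLinearMap (Matrix.mulVecLin (Matrix.of A)))
  have hcovz : ∀ m m', cov[fun z : Fin M → ℝ => z m, fun z => z m'; ν] =
      if m = m' then 1 else 0 := by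
    intro m m'
    split_ifs with h
    · subst h
      rw [covariance_self (hmem m).aemeasurable, (heval m).variance_eq]
      simp
    · exact (hind.indepFun h).covariance_eq_zero (hmem m) (hmem m')
  have hYm : Measurable Y := by fun_prop
  have hlaw : P.map X = ν.map Y := by
    refine HasGaussianLaw.map_eq_of_covariance_eq hX hY (fun i => ?_) fun i j => ?_
    · rw [hmean, integral_finsetSum _ fun m _ => ((hG.eval m).integrable).const_mul _]
      simp_rw [integral_const_mul, (heval _).integral_eq]
      simp
    · rw [hcov, covariance_fun_sum_fun_sum (fun m => (hmem m).const_mul _)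
        fun m => (hmem m).const_mul _]
      simp_rw [covariance_const_mul_left, covariance_const_mul_right, hcovz]
      simp
  rw [hlaw]
  exact (PosAssoc.pi _).map hYm fun z z' hz i =>
    Finset.sum_le_sum fun m _ => mul_le_mul_of_nonneg_left (hz m) (hA i m)

lemma IsSlepian.hasGaussianLaw {Ω : Type*} [MeasurableSpace Ω] {μ : Measure Ω}
    {S : ℝ → Ω → ℝ} (hS : IsSlepian μ S) {n : ℕ} (t : Fin n → ℝ) :
    HasGaussianLaw (fun ω i => S (t i) ω) μ where
  isGaussian_map := by
    obtain ⟨_, hmeas, -, hlin, -, -⟩ := hS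
    refine isGaussian_of_map_eq_gaussianReal fun L => ?_
    obtain ⟨c, hc⟩ := StrongDual.exists_pi_apply_eq_sum L
    obtain ⟨v, hv⟩ := hlin n t c
    refine ⟨0, v, ?_⟩
    rw [Measure.map_map (by fun_prop) (measurable_pi_lambda _ fun i => hmeas (t i)), ← hv]
    congr 1
    ext ω
    exact hc _

lemma IsSlepian.covariance_eq {Ω : Type*} [MeasurableSpace Ω] {μ : Measure Ω}
    {S : ℝ → Ω → ℝ} (hS : IsSlepian μ S) (s t : ℝ) :
    cov[S s, S t; μ] = max 0 (1 - |s - t|) := by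
  have := hS.1
  have hmem : ∀ t, MemLp (S t) 2 μ := fun t =>
    ((hS.hasGaussianLaw fun _ : Fin 1 => t).eval 0).memLp_two
  rw [covariance_eq_sub (hmem s) (hmem t), hS.2.2.2.2.1, zero_mul, sub_zero]
  exact hS.2.2.2.2.2 s t

/-- The finite-dimensional distributions of a Slepian process are shift invariant. -/
lemma IsSlepian.map_shift {Ω : Type*} [MeasurableSpace Ω] {μ : Measure Ω}
    {S : ℝ → Ω → ℝ} (hS : IsSlepian μ S) {n : ℕ} (t : Fin n → ℝ) (a : ℝ) :
    μ.map (fun ω i => S (a + t i) ω) = μ.map fun ω i => S (t i) ω := by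
  refine HasGaussianLaw.map_eq_of_covariance_eq (hS.hasGaussianLaw fun i => a + t i)
    (hS.hasGaussianLaw t) (fun i => ?_) fun i j => ?_
  · rw [hS.2.2.2.2.1, hS.2.2.2.2.1]
  · rw [hS.covariance_eq, hS.covariance_eq, add_sub_add_left_eq_sub]

/-- Two windows of length `n` started at `k` and `l` share `n - |k - l|` points. -/
lemma sum_indicator_window_mul {n N k l : ℕ} (hk : k < N) :
    ∑ m : Fin (N + n), (if k ≤ (m : ℕ) ∧ (m : ℕ) < k + n then (1 : ℝ) else 0) *
      (if l ≤ (m : ℕ) ∧ (m : ℕ) < l + n then 1 else 0) =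
      max 0 ((n : ℝ) - |(k : ℝ) - l|) := by
  rw [Fin.sum_univ_eq_sum_range (fun m => (if k ≤ m ∧ m < k + n then (1 : ℝ) else 0) *
      (if l ≤ m ∧ m < l + n then 1 else 0))]
  simp_rw [ite_zero_mul_ite_zero, mul_one, ← Finset.sum_filter, Finset.sum_const, nsmul_one]
  have : (Finset.range (N + n)).filter
      (fun m => (k ≤ m ∧ m < k + n) ∧ l ≤ m ∧ m < l + n) =
      Finset.Ico (max k l) (min k l + n) := by
    ext m
    simp only [Finset.mem_filter, Finset.mem_range, Finset.mem_Ico]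
    omega
  rw [this, Nat.card_Ico]
  rcases le_total k l with h | h
  · rw [max_eq_right h, min_eq_left h, abs_sub_comm, abs_of_nonneg (by simpa using h)]
    rcases le_total l (k + n) with h' | h'
    · rw [Nat.cast_sub h', max_eq_right (by rify at h'; linarith)]
      push_cast; ring
    · rw [Nat.sub_eq_zero_of_le h', max_eq_left (by rify at h'; linarith)]
      simp
  · rw [max_eq_left h, min_eq_right h, abs_of_nonneg (by simpa using h)]
    rcases le_total k (l + n) with h' | h'
    · rw [Nat.cast_sub h', max_eq_right (by rify at h'; linarith)]
      push_cast; ring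
    · rw [Nat.sub_eq_zero_of_le h', max_eq_left (by rify at h'; linarith)]
      simp

/-- On the grid `k / n`, a Slepian process is a moving sum of independent Gaussian variables,
hence positively associated. -/
lemma IsSlepian.posAssoc_grid {Ω : Type*} [MeasurableSpace Ω] {μ : Measure Ω}
    {S : ℝ → Ω → ℝ} (hS : IsSlepian μ S) {n : ℕ} (hn : 0 < n) (N : ℕ) :
    PosAssoc (μ.map fun ω (k : Fin N) => S ((k : ℕ) / n : ℝ) ω) := by
  have hn' : (0 : ℝ) < n := by exact_mod_cast hn
  refine HasGaussianLaw.posAssoc_map (hS.hasGaussianLaw fun k : Fin N => ((k : ℕ) / n : ℝ))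
    (fun _ => hS.2.2.2.2.1 _) (M := N + n)
    (fun k m => (√(n : ℝ))⁻¹ * if (k : ℕ) ≤ (m : ℕ) ∧ (m : ℕ) < k + n then 1 else 0)
    (fun k m => by positivity) fun k l => ?_
  rw [hS.covariance_eq]
  rw [Finset.sum_congr rfl fun m _ => mul_mul_mul_comm _ _ _ _, ← Finset.mul_sum, sum_indicator_window_mul k.2, ← mul_inv, Real.mul_self_sqrt hn'.le,
    ← sub_div, abs_div, abs_of_pos hn', mul_max_of_nonneg _ _ (by positivity)]
  congr 1
  · simp
  · field_simp

lemma IsSlepian.grid_real_mul_le {Ω : Type*} [MeasurableSpace Ω] {μ : Measure Ω}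
    {S : ℝ → Ω → ℝ} (hS : IsSlepian μ S) {n : ℕ} (hn : 0 < n) (a b : ℕ) (h : ℝ) :
    μ.real {ω | ∀ k < a, S ((k : ℕ) / n : ℝ) ω ≤ h} *
      μ.real {ω | ∀ k < b, S ((k : ℕ) / n : ℝ) ω ≤ h} ≤
      μ.real {ω | ∀ k < a + b, S ((k : ℕ) / n : ℝ) ω ≤ h} := by
  have hX : ∀ {m : ℕ} (t : Fin m → ℝ), Measurable fun ω i => S (t i) ω := fun t =>
    measurable_pi_lambda _ fun i => hS.2.1 (t i)
  have hms : ∀ {m : ℕ} (p : Fin m → Prop), MeasurableSet {x : Fin m → ℝ | ∀ i, p i → x i ≤ h} :=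
    fun p => by
      simp_rw [Set.ofPred_forall]
      exact MeasurableSet.iInter fun i => MeasurableSet.iInter fun _ =>
        measurableSet_le (measurable_pi_apply i) measurable_const
  have hlow : ∀ {m : ℕ} (p : Fin m → Prop), IsLowerSet {x : Fin m → ℝ | ∀ i, p i → x i ≤ h} :=
    fun p x y hyx hx i hi => (hyx i).trans (hx i hi)
  have key := (hS.posAssoc_grid hn (a + b)).real_mul_le_real_inter
    (hms fun k => (k : ℕ) < a) (hms fun k => a ≤ (k : ℕ)) (hlow _) (hlow _)
  rw [map_measureReal_apply (hX _) (hms _), map_measureReal_apply (hX _) (hms _),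
    map_measureReal_apply (hX _) ((hms _).inter (hms _))] at key
  have hfst : (fun ω (k : Fin (a + b)) => S ((k : ℕ) / n : ℝ) ω) ⁻¹'
      {x | ∀ k : Fin (a + b), (k : ℕ) < a → x k ≤ h} = {ω | ∀ k < a, S ((k : ℕ) / n : ℝ) ω ≤ h} := by
    ext ω
    exact ⟨fun H k hk => H ⟨k, by omega⟩ hk, fun H k hk => H k hk⟩
  have hboth : (fun ω (k : Fin (a + b)) => S ((k : ℕ) / n : ℝ) ω) ⁻¹'
      ({x | ∀ k : Fin (a + b), (k : ℕ) < a → x k ≤ h} ∩ {x | ∀ k : Fin (a + b), a ≤ (k : ℕ) → x k ≤ h}) =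
      {ω | ∀ k < a + b, S ((k : ℕ) / n : ℝ) ω ≤ h} := by
    ext ω
    refine ⟨fun H k hk => ?_, fun H => ⟨fun k _ => H k k.2, fun k _ => H k k.2⟩⟩
    exact (lt_or_ge k a).elim (H.1 ⟨k, hk⟩) (H.2 ⟨k, hk⟩)
  have hsnd : (fun ω (k : Fin (a + b)) => S ((k : ℕ) / n : ℝ) ω) ⁻¹'
      {x | ∀ k : Fin (a + b), a ≤ (k : ℕ) → x k ≤ h} =
      (fun ω (k : Fin b) => S ((a / n : ℝ) + (k : ℕ) / n) ω) ⁻¹' {x | ∀ k, True → x k ≤ h} := by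
    ext ω
    simp only [mem_preimage, mem_ofPred_eq, true_imp_iff, ← add_div, ← Nat.cast_add]
    refine ⟨fun H k => H ⟨a + k, by omega⟩ (by simp), fun H k hk => ?_⟩
    have := H ⟨k - a, by omega⟩
    rwa [Nat.add_sub_cancel' hk] at this
  rw [hfst, hboth, hsnd, ← map_measureReal_apply (hX _) (hms _),
    hS.map_shift (fun k : Fin b => ((k : ℕ) / n : ℝ)), map_measureReal_apply (hX _) (hms _)] at key
  convert key using 3
  ext ω
  exact ⟨fun H k _ => H k k.2, fun H k hk => H ⟨k, hk⟩ trivial⟩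

lemma IsSlepian.real_le_mul_le {Ω : Type*} [MeasurableSpace Ω] {μ : Measure Ω}
    {S : ℝ → Ω → ℝ} (hS : IsSlepian μ S) {T T' : ℝ} (hT : 0 ≤ T) (hT' : 0 ≤ T') (h : ℝ) :
    μ.real {ω | ∀ t ∈ Icc 0 T, S t ω ≤ h} * μ.real {ω | ∀ t ∈ Icc 0 T', S t ω ≤ h} ≤
      μ.real {ω | ∀ t ∈ Icc 0 (T + T'), S t ω ≤ h} := by
  have := hS.1
  set D : ℕ → Set Ω := fun m =>
    {ω | ∀ k : ℕ, (k / (2 ^ m : ℕ) : ℝ) ≤ T + T' → S (k / (2 ^ m : ℕ) : ℝ) ω ≤ h} with hD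
  have hDmeas : ∀ m, MeasurableSet (D m) := fun m => by
    simp_rw [hD, Set.ofPred_forall]
    exact MeasurableSet.iInter fun k => MeasurableSet.iInter fun _ =>
      measurableSet_le (hS.2.1 _) measurable_const
  have hDanti : Antitone D := by
    refine antitone_nat_of_succ_le fun m ω hω k hk => ?_
    have heq : ((2 * k : ℕ) / (2 ^ (m + 1) : ℕ) : ℝ) = k / (2 ^ m : ℕ) := by
      push_cast
      rw [pow_succ']
      exact mul_div_mul_left _ _ two_ne_zero
    rw [← heq]
    exact hω _ (heq ▸ hk)
  have hDiInter : ⋂ m, D m = {ω | ∀ t ∈ Icc 0 (T + T'), S t ω ≤ h} := by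
    ext ω
    simp only [mem_iInter]
    refine ⟨fun H t ht => ?_, fun H m k hk => H _ ⟨by positivity, hk⟩⟩
    have hlim : Tendsto (fun m : ℕ => (⌊t * (2 ^ m : ℕ)⌋₊ / (2 ^ m : ℕ) : ℝ)) atTop (nhds t) :=
      (tendsto_nat_floor_mul_div_atTop ht.1).comp <| tendsto_natCast_atTop_atTop.comp <|
        tendsto_pow_atTop_atTop_of_one_lt one_lt_two
    refine le_of_tendsto (((hS.2.2.1 ω).tendsto t).comp hlim) (.of_forall fun m => H m _ ?_)
    refine le_trans ?_ ht.2
    rw [div_le_iff₀ (by positivity)]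
    exact Nat.floor_le (mul_nonneg ht.1 (by positivity))
  have hbound : ∀ m, μ.real {ω | ∀ t ∈ Icc 0 T, S t ω ≤ h} *
      μ.real {ω | ∀ t ∈ Icc 0 T', S t ω ≤ h} ≤ μ.real (D m) := by
    intro m
    have hpos : 0 < 2 ^ m := by positivity
    have hposR : (0 : ℝ) < (2 ^ m : ℕ) := by exact_mod_cast hpos
    have hsub : ∀ {U : ℝ}, 0 ≤ U → {ω | ∀ t ∈ Icc 0 U, S t ω ≤ h} ⊆
        {ω | ∀ k < ⌊U * (2 ^ m : ℕ)⌋₊ + 1, S ((k : ℕ) / (2 ^ m : ℕ) : ℝ) ω ≤ h} := by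
      intro U hU ω hω k hk
      refine hω _ ⟨by positivity, ?_⟩
      rw [div_le_iff₀ hposR]
      exact (Nat.le_floor_iff (by positivity)).1 (Nat.lt_succ_iff.1 hk)
    refine (mul_le_mul (measureReal_mono (hsub hT)) (measureReal_mono (hsub hT'))
      measureReal_nonneg measureReal_nonneg).trans
      ((hS.grid_real_mul_le hpos _ _ h).trans (measureReal_mono fun ω hω k hk => hω k ?_))
    rw [div_le_iff₀ hposR, add_mul] at hk
    have h₁ := Nat.lt_floor_add_one (T * (2 ^ m : ℕ))
    have h₂ := Nat.lt_floor_add_one (T' * (2 ^ m : ℕ))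
    have : (k : ℝ) < (⌊T * (2 ^ m : ℕ)⌋₊ + 1 + (⌊T' * (2 ^ m : ℕ)⌋₊ + 1) : ℕ) := by
      push_cast at *
      linarith
    exact_mod_cast this
  have htend : Tendsto (fun m => μ.real (D m)) atTop
      (nhds (μ.real {ω | ∀ t ∈ Icc 0 (T + T'), S t ω ≤ h})) := by
    rw [← hDiInter]
    exact (ENNReal.tendsto_toReal (measure_ne_top _ _)).comp <|
      tendsto_measure_iInter_atTop (fun m => (hDmeas m).nullMeasurableSet) hDanti
        ⟨0, measure_ne_top _ _⟩
  exact ge_of_tendsto' htend hbound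

/-- `F_T(h)` is the left limit of the probabilities that the process is at most `x`. -/
lemma IsSlepian.tendsto_slepF {Ω : Type*} [MeasurableSpace Ω] {μ : Measure Ω}
    {S : ℝ → Ω → ℝ} (hS : IsSlepian μ S) {T : ℝ} (hT : 0 ≤ T) (h : ℝ) :
    Tendsto (fun m : ℕ => μ.real {ω | ∀ t ∈ Icc 0 T, S t ω ≤ h - 1 / ((m : ℝ) + 1)}) atTop
      (nhds (slepF μ S T h)) := by
  have := hS.1
  have hmono : Monotone fun m : ℕ => {ω | ∀ t ∈ Icc 0 T, S t ω ≤ h - 1 / ((m : ℝ) + 1)} :=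
    fun m m' hm ω hω t ht =>
      (hω t ht).trans (sub_le_sub_left (Nat.one_div_le_one_div hm) h)
  have hiUnion : ⋃ m : ℕ, {ω | ∀ t ∈ Icc 0 T, S t ω ≤ h - 1 / ((m : ℝ) + 1)} =
      {ω | ∀ t ∈ Icc 0 T, S t ω < h} := by
    ext ω
    simp only [mem_iUnion]
    refine ⟨fun ⟨m, hm⟩ t ht => (hm t ht).trans_lt (sub_lt_self h Nat.one_div_pos_of_nat),
      fun H => ?_⟩
    obtain ⟨s, hs, hmax⟩ := isCompact_Icc.exists_isMaxOn (nonempty_Icc.2 hT)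
      (hS.2.2.1 ω).continuousOn
    obtain ⟨m, hm⟩ := exists_nat_one_div_lt (sub_pos.2 (H s hs))
    exact ⟨m, fun t ht => (hmax ht).trans (by linarith)⟩
  rw [slepF, ← hiUnion]
  exact (ENNReal.tendsto_toReal (measure_ne_top _ _)).comp (tendsto_measure_iUnion_atTop hmono)

/-- Superadditivity of `T ↦ log F_T(h)`: for all `T, T' ≥ 0`,
`F_{T+T'}(h) ≥ F_T(h) ⬝ F_{T'}(h)` (a consequence of Slepian's inequality). -/
theorem slepF_superadditive {Ω : Type*} [MeasurableSpace Ω] (μ : Measure Ω)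
    (S : ℝ → Ω → ℝ) (hS : IsSlepian μ S) (h T T' : ℝ) (hT : 0 ≤ T) (hT' : 0 ≤ T') :
    slepF μ S T h * slepF μ S T' h ≤ slepF μ S (T + T') h :=
  le_of_tendsto_of_tendsto' ((hS.tendsto_slepF hT h).mul (hS.tendsto_slepF hT' h))
    (hS.tendsto_slepF (add_nonneg hT hT') h) fun _ => hS.real_le_mul_le hT hT' _
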